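/- arXiv:2009.02924 — 4 statements merged into one kernel-verified Lean document; each statement's English description precedes it below -/
import Mathlib

section
/- (Proposition 3.1.) Assume the nominal closed loop is exponentially stable, i.e. there exists δ > 0 such that every λ ∈ ℂ with H₀(λ) = 0 satisfies Re λ ≤ −δ. If the spectral radius of B·K_d·C (the maximum of |μ| over the complex eigenvalues μ of B·K_d·C) is strictly larger than 1, then for every feedback delay r > 0 there exists λ ∈ ℂ with Re λ > 0 and H₁(λ; r) = 0; that is, the closed loop with delayed feedback is unstable for every r > 0. -/
open Matrix

/-- A real matrix regarded as a complex matrix. -/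
noncomputable def cM {a b : ℕ} (M : Matrix (Fin a) (Fin b) ℝ) : Matrix (Fin a) (Fin b) ℂ :=
  M.map (fun x => (x : ℂ))

/-- The nominal closed-loop characteristic function `H₀`. -/
noncomputable def H0 {n m p q K : ℕ}
    (A0 : Matrix (Fin n) (Fin n) ℝ) (A : Fin K → Matrix (Fin n) (Fin n) ℝ)
    (τ : Fin K → ℝ)
    (B : Matrix (Fin n) (Fin m) ℝ) (C : Matrix (Fin p) (Fin n) ℝ)
    (Kp Kd : Matrix (Fin m) (Fin p) ℝ)
    (Ui : Matrix (Fin m) (Fin q) ℝ) (Vi : Matrix (Fin q) (Fin p) ℝ)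
    (lam : ℂ) : ℂ :=
  (lam • Matrix.fromBlocks (1 - cM B * cM Kd * cM C) 0 0 (1 : Matrix (Fin q) (Fin q) ℂ)
    - Matrix.fromBlocks (cM A0 + cM B * cM Kp * cM C) (cM B * cM Ui) (cM Vi * cM C) 0
    - ∑ k : Fin K, Complex.exp (-lam * (τ k : ℂ)) •
        Matrix.fromBlocks (cM (A k)) 0 0 (0 : Matrix (Fin q) (Fin q) ℂ)).det

/-- The characteristic function `H₁(λ; r)` of the closed loop with feedback delay `r`. -/
noncomputable def H1 {n m p q K : ℕ}
    (A0 : Matrix (Fin n) (Fin n) ℝ) (A : Fin K → Matrix (Fin n) (Fin n) ℝ)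
    (τ : Fin K → ℝ)
    (B : Matrix (Fin n) (Fin m) ℝ) (C : Matrix (Fin p) (Fin n) ℝ)
    (Kp Kd : Matrix (Fin m) (Fin p) ℝ)
    (Ui : Matrix (Fin m) (Fin q) ℝ) (Vi : Matrix (Fin q) (Fin p) ℝ)
    (lam : ℂ) (r : ℝ) : ℂ :=
  (lam • ((1 : Matrix (Fin n ⊕ Fin q) (Fin n ⊕ Fin q) ℂ)
      - Complex.exp (-lam * (r : ℂ)) •
          Matrix.fromBlocks (cM B * cM Kd * cM C) 0 0 (0 : Matrix (Fin q) (Fin q) ℂ))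
    - Matrix.fromBlocks (cM A0) 0 (cM Vi * cM C) (0 : Matrix (Fin q) (Fin q) ℂ)
    - Complex.exp (-lam * (r : ℂ)) •
        Matrix.fromBlocks (cM B * cM Kp * cM C) (cM B * cM Ui) 0 (0 : Matrix (Fin q) (Fin q) ℂ)
    - ∑ k : Fin K, Complex.exp (-lam * (τ k : ℂ)) •
        Matrix.fromBlocks (cM (A k)) 0 0 (0 : Matrix (Fin q) (Fin q) ℂ)).det

open Metric Filter Topology in
lemma aux_zero (f : ℂ → ℂ) (c : ℂ) (ρ ε : ℝ) (hρ : 0 < ρ)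
    (hf : ∀ z ∈ closedBall c ρ, DifferentiableAt ℂ f z)
    (hc : ‖f c‖ < ε) (hs : ∀ z ∈ sphere c ρ, ε ≤ ‖f z‖) :
    ∃ z ∈ closedBall c ρ, f z = 0 := by
  by_contra! hne
  have hε : 0 < ε := lt_of_le_of_lt (norm_nonneg _) hc
  have hd : DiffContOnCl ℂ (fun z => (f z)⁻¹) (ball c ρ) := by
    apply DifferentiableOn.diffContOnCl
    rw [closure_ball c hρ.ne']
    intro z hz
    exact ((hf z hz).inv (hne z hz)).differentiableWithinAt
  have := Complex.norm_le_of_forall_mem_frontier_norm_le (U := ball c ρ) isBounded_ball hd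
    (C := ε⁻¹) (by
      intro z hz
      rw [frontier_ball c hρ.ne'] at hz
      rw [norm_inv]
      exact inv_anti₀ hε (hs z hz)) (z := c) (subset_closure (mem_ball_self hρ))
  rw [norm_inv] at this
  have hpos : 0 < ‖f c‖ := norm_pos_iff.2 (hne c (mem_closedBall_self hρ.le))
  have := (inv_le_inv₀ hpos hε).1 this
  linarith

lemma aux_det_diff {ι : Type*} [Fintype ι] [DecidableEq ι] (M : ℂ → Matrix ι ι ℂ) (z : ℂ)
    (h : ∀ i j, DifferentiableAt ℂ (fun z => M z i j) z) :
    DifferentiableAt ℂ (fun z => (M z).det) z := by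
  simp only [Matrix.det_apply]
  refine DifferentiableAt.fun_sum fun σ _ => ?_
  refine DifferentiableAt.const_smul (?_) _
  exact DifferentiableAt.fun_finsetProd fun i _ => h _ _

/-- normalized characteristic matrix -/
noncomputable def auxQ {ι : Type*} [Fintype ι] [DecidableEq ι] {K : ℕ} (D L P : Matrix ι ι ℂ)
    (A : Fin K → Matrix ι ι ℂ) (w s : ℂ) (u : Fin K → ℂ) : Matrix ι ι ℂ :=
  1 - w • D - s • (L + w • P + ∑ k, u k • A k)

open Metric Filter Topology in
lemma aux_main {ι : Type*} [Fintype ι] [DecidableEq ι] {K : ℕ} (D L P : Matrix ι ι ℂ)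
    (A : Fin K → Matrix ι ι ℂ) (τ : Fin K → ℝ) (hτ : ∀ k, 0 < τ k) (r : ℝ) (hr : 0 < r)
    (μ : ℂ) (hμ : 1 < ‖μ‖) (hD : (1 - μ⁻¹ • D).det = 0) :
    ∃ lam : ℂ, 0 < lam.re ∧ (auxQ D L P A (Complex.exp (-lam * r)) lam⁻¹
      (fun k => Complex.exp (-lam * τ k))).det = 0 := by
  have hμ0 : μ ≠ 0 := by rintro rfl; simp at hμ; linarith
  have hrC : (r : ℂ) ≠ 0 := by exact_mod_cast hr.ne'
  set g : ℂ → ℂ := fun z => (1 - (μ⁻¹ * Complex.exp (-z * r)) • D).det with hg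
  have hgd : Differentiable ℂ g := fun z => by
    apply aux_det_diff
    intro i j
    simp only [Matrix.sub_apply, Matrix.smul_apply, smul_eq_mul]
    fun_prop
  have hg0 : g 0 = 0 := by simpa [hg] using hD
  have hgne : ∀ᶠ z in 𝓝[≠] (0 : ℂ), g z ≠ 0 := by
    rcases (hgd.analyticAt 0).eventually_eq_zero_or_eventually_ne_zero with h | h
    · exfalso
      have hz : g = fun _ => 0 :=
        AnalyticOnNhd.eq_of_eventuallyEq (fun z _ => hgd.analyticAt z)
          (fun z _ => analyticAt_const) h
      have hp : Continuous (fun w : ℂ => (1 - (μ⁻¹ * w) • D).det) := by fun_prop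
      have hw : ∀ w : ℂ, w ≠ 0 → (1 - (μ⁻¹ * w) • D).det = 0 := by
        intro w hw
        have := congrFun hz (-Complex.log w / r)
        simp only [hg] at this
        rwa [show -(-Complex.log w / r) * (r : ℂ) = Complex.log w by field_simp,
          Complex.exp_log hw] at this
      have : (fun w : ℂ => (1 - (μ⁻¹ * w) • D).det) = fun _ => 0 :=
        hp.ext_on (dense_compl_singleton (0 : ℂ)) continuous_const (fun w h => hw w h)
      have := congrFun this 0
      simp at this
    · exact h
  obtain ⟨ρ₀, hρ₀, hball⟩ := Metric.mem_nhdsWithin_iff.1 hgne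
  have hlog : 0 < Real.log ‖μ‖ / r := div_pos (Real.log_pos hμ) hr
  obtain ⟨ρ, hρ, hρlt⟩ := exists_between (lt_min hρ₀ hlog)
  have hρ1 := hρlt.trans_le (min_le_left _ _)
  have hρ2 := hρlt.trans_le (min_le_right _ _)
  have hgs : ∀ z ∈ sphere (0 : ℂ) ρ, g z ≠ 0 := by
    intro z hz
    apply hball
    simp only [mem_sphere, dist_zero_right] at hz
    refine ⟨by simpa [hz] using hρ1, ?_⟩
    rintro rfl
    simp at hz; linarith
  obtain ⟨z₀, hz₀, hmin⟩ := (isCompact_sphere (0 : ℂ) ρ).exists_isMinOn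
    (NormedSpace.sphere_nonempty.2 hρ.le) (hgd.continuous.norm.continuousOn)
  set ε := ‖g z₀‖ / 2 with hε
  have hεpos : 0 < ε := half_pos (norm_pos_iff.2 (hgs z₀ hz₀))
  -- uniform closeness
  set G : ℂ → ℂ × (Fin K → ℂ) → ℂ := fun s x =>
    (auxQ D L P A (μ⁻¹ * Complex.exp (-x.1 * r)) s x.2).det with hG
  have hGc : Continuous (fun y : ℂ × (ℂ × (Fin K → ℂ)) => G y.1 y.2) := by
    simp only [hG, auxQ]
    fun_prop
  have hGg : ∀ x, G 0 x = g x.1 := by intro x; simp [hG, hg, auxQ]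
  have hcomp : IsCompact (closedBall (0 : ℂ) ρ ×ˢ closedBall (0 : Fin K → ℂ) 1) :=
    (isCompact_closedBall _ _).prod (isCompact_closedBall _ _)
  have hev : ∀ᶠ s in 𝓝 (0 : ℂ), ∀ x ∈ closedBall (0 : ℂ) ρ ×ˢ closedBall (0 : Fin K → ℂ) 1,
      ‖G s x - g x.1‖ < ε := by
    apply hcomp.eventually_forall_of_forall_eventually
    intro x _
    have hc : Continuous (fun y : ℂ × (ℂ × (Fin K → ℂ)) => ‖G y.1 y.2 - g y.2.1‖) := by
      have := hgd.continuous
      fun_prop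
    have := hc.tendsto (0, x)
    simp only [hGg, sub_self, norm_zero] at this
    exact this.eventually_lt_const hεpos
  obtain ⟨η, hη, hηb⟩ := Metric.eventually_nhds_iff.1 hev
  -- the centre
  obtain ⟨k, hk⟩ := exists_nat_gt ((η⁻¹ + ρ) * r + |(Complex.log μ).im|)
  set c : ℂ := (Complex.log μ + k * (2 * Real.pi * Complex.I)) / r with hc
  have hcre : c.re = Real.log ‖μ‖ / r := by
    simp [hc, Complex.div_ofReal_re, Complex.log_re]
  have hcim : c.im = ((Complex.log μ).im + k * (2 * Real.pi)) / r := by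
    simp [hc, Complex.div_ofReal_im]
  have hcim' : η⁻¹ + ρ < c.im := by
    rw [hcim, lt_div_iff₀ hr]
    have := neg_abs_le (Complex.log μ).im
    have h1 : (2 : ℝ) ≤ 2 * Real.pi := by linarith [Real.pi_gt_three]
    have h2 : (0 : ℝ) ≤ k := Nat.cast_nonneg k
    have hk0 := abs_nonneg (Complex.log μ).im
    have h3 : (0 : ℝ) ≤ (η⁻¹ + ρ) * r := by positivity
    rcases le_total |(Complex.log μ).im| ((k : ℝ)) with h | h <;> nlinarith
  have hexp : ∀ z : ℂ, Complex.exp (-(c + z) * r) = μ⁻¹ * Complex.exp (-z * r) := by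
    intro z
    rw [show -(c + z) * (r : ℂ) = -(Complex.log μ + k * (2 * Real.pi * Complex.I)) + -z * r by
      rw [hc]; field_simp; ring, Complex.exp_add, Complex.exp_neg, Complex.exp_add,
      Complex.exp_log hμ0, Complex.exp_nat_mul_two_pi_mul_I, mul_one]
  have hre : ∀ z ∈ closedBall (0 : ℂ) ρ, 0 < (c + z).re := by
    intro z hz
    simp only [mem_closedBall, dist_zero_right] at hz
    have := Complex.abs_re_le_norm z
    have := neg_abs_le z.re
    rw [Complex.add_re, hcre]; linarith
  set f : ℂ → ℂ := fun z => (auxQ D L P A (Complex.exp (-(c + z) * r)) (c + z)⁻¹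
      (fun k => Complex.exp (-(c + z) * τ k))).det with hf
  have hfg : ∀ z ∈ closedBall (0 : ℂ) ρ, ‖f z - g z‖ < ε := by
    intro z hz
    have h0 := hre z hz
    have key := hηb (y := (c + z)⁻¹) ?_ (z, fun k => Complex.exp (-(c + z) * τ k)) ⟨hz, ?_⟩
    · simpa only [hG, hf, hexp] using key
    · simp only [mem_closedBall, dist_zero_right] at hz
      have h1 := Complex.abs_im_le_norm z
      have h2 := neg_abs_le z.im
      have h3 := Complex.abs_im_le_norm (c + z)
      have h4 := le_abs_self (c + z).im
      rw [Complex.add_im] at h3 h4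
      have h5 : η⁻¹ < ‖c + z‖ := by linarith
      rw [dist_zero_right, norm_inv]
      exact inv_lt_of_inv_lt₀ hη h5
    · rw [mem_closedBall, dist_zero_right, pi_norm_le_iff_of_nonneg zero_le_one]
      intro j
      rw [Complex.norm_exp, Real.exp_le_one_iff]
      simp only [Complex.mul_re, Complex.neg_re, Complex.ofReal_re, Complex.ofReal_im, mul_zero,
        sub_zero]
      nlinarith [mul_pos h0 (hτ j)]
  obtain ⟨z, hz, hfz⟩ := aux_zero f 0 ρ ε hρ (by
      intro z hz
      have h0 : c + z ≠ 0 := by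
        intro h; have := hre z hz; rw [h] at this; simp at this
      apply aux_det_diff
      intro i j
      simp only [auxQ, Matrix.sub_apply, Matrix.smul_apply, Matrix.add_apply, Matrix.sum_apply,
        smul_eq_mul]
      fun_prop (disch := assumption))
    (by have := hfg 0 (mem_closedBall_self hρ.le); rwa [hg0, sub_zero] at this)
    (by
      intro z hz
      have h1 := hfg z (sphere_subset_closedBall hz)
      have h2 : ‖g z₀‖ ≤ ‖g z‖ := hmin hz
      have h3 := norm_sub_norm_le (g z) (f z)
      rw [norm_sub_rev] at h3
      linarith)
  exact ⟨c + z, hre z hz, hfz⟩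

/-- Proposition 3.1: if the nominal closed loop is exponentially stable and the
spectral radius of `B·K_d·C` exceeds `1`, then the closed loop with delayed
feedback is unstable for every delay `r > 0`. -/
theorem stmt4 {n m p q K : ℕ}
    (hn : 0 < n) (hm : 0 < m) (hp : 0 < p) (hK : 0 < K)
    (A0 : Matrix (Fin n) (Fin n) ℝ) (A : Fin K → Matrix (Fin n) (Fin n) ℝ)
    (τ : Fin K → ℝ) (hτpos : ∀ k, 0 < τ k) (hτmono : StrictMono τ)
    (B : Matrix (Fin n) (Fin m) ℝ) (hB : B.rank = m)
    (C : Matrix (Fin p) (Fin n) ℝ) (hC : C.rank = p)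
    (Kp Kd Ki : Matrix (Fin m) (Fin p) ℝ)
    (Ui : Matrix (Fin m) (Fin q) ℝ) (Vi : Matrix (Fin q) (Fin p) ℝ)
    (hfact : Ki = Ui * Vi) (hUi : Ui.rank = q) (hVi : Vi.rank = q) (hKi : Ki.rank = q)
    (hstab : ∃ δ : ℝ, 0 < δ ∧ ∀ lam : ℂ,
      H0 A0 A τ B C Kp Kd Ui Vi lam = 0 → lam.re ≤ -δ)
    (hρ : ∃ μ : ℂ,
      (μ • (1 : Matrix (Fin n) (Fin n) ℂ) - cM B * cM Kd * cM C).det = 0 ∧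
      1 < ‖μ‖) :
    ∀ r : ℝ, 0 < r → ∃ lam : ℂ, 0 < lam.re ∧
      H1 A0 A τ B C Kp Kd Ui Vi lam r = 0 := by
  intro r hr
  obtain ⟨μ, hdet, hμ⟩ := hρ
  have hμ0 : μ ≠ 0 := by rintro rfl; simp at hμ; linarith
  obtain ⟨lam, hre, hz⟩ := aux_main
    (Matrix.fromBlocks (cM B * cM Kd * cM C) 0 0 (0 : Matrix (Fin q) (Fin q) ℂ))
    (Matrix.fromBlocks (cM A0) 0 (cM Vi * cM C) (0 : Matrix (Fin q) (Fin q) ℂ))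
    (Matrix.fromBlocks (cM B * cM Kp * cM C) (cM B * cM Ui) 0 (0 : Matrix (Fin q) (Fin q) ℂ))
    (fun k => Matrix.fromBlocks (cM (A k)) 0 0 (0 : Matrix (Fin q) (Fin q) ℂ))
    τ hτpos r hr μ hμ (by
      rw [← Matrix.fromBlocks_one, Matrix.fromBlocks_smul, sub_eq_add_neg, Matrix.fromBlocks_neg,
        Matrix.fromBlocks_add]
      simp only [smul_zero, neg_zero, add_zero, ← sub_eq_add_neg, Matrix.det_fromBlocks_zero₂₁, Matrix.det_one, mul_one]
      rw [show (1 : Matrix (Fin n) (Fin n) ℂ) - μ⁻¹ • (cM B * cM Kd * cM C)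
        = μ⁻¹ • (μ • (1 : Matrix (Fin n) (Fin n) ℂ) - cM B * cM Kd * cM C) by
          rw [smul_sub, smul_smul, inv_mul_cancel₀ hμ0, one_smul], Matrix.det_smul, hdet, mul_zero])
  refine ⟨lam, hre, ?_⟩
  have hl : lam ≠ 0 := by rintro rfl; simp at hre
  have := Matrix.det_smul (auxQ
    (Matrix.fromBlocks (cM B * cM Kd * cM C) 0 0 (0 : Matrix (Fin q) (Fin q) ℂ))
    (Matrix.fromBlocks (cM A0) 0 (cM Vi * cM C) (0 : Matrix (Fin q) (Fin q) ℂ))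
    (Matrix.fromBlocks (cM B * cM Kp * cM C) (cM B * cM Ui) 0 (0 : Matrix (Fin q) (Fin q) ℂ))
    (fun k => Matrix.fromBlocks (cM (A k)) 0 0 (0 : Matrix (Fin q) (Fin q) ℂ))
    (Complex.exp (-lam * r)) lam⁻¹ (fun k => Complex.exp (-lam * τ k))) lam
  rw [hz, mul_zero] at this
  rw [← this, H1, auxQ, smul_sub _ _ (lam⁻¹ • _), smul_smul, mul_inv_cancel₀ hl, one_smul]
  congr 1
  abel
end

section
/- (Proposition 4.4, odd-number limitation.) Fix K_p and K_i = U_i·V_i, and let H₀^{(0)} denote the nominal characteristic function H₀ obtained with the derivative gain equal to the zero matrix. Assume H₀^{(0)} is not identically zero, that the set Z = { λ ∈ ℂ : Re λ ≥ 0 and H₀^{(0)}(λ) = 0 } is finite, and that the sum over λ ∈ Z of the multiplicities of λ as a zero of the entire function H₀^{(0)} is odd. Then there exists no matrix K_d ∈ ℝ^{m×p} such that simultaneously (a) there exists δ > 0 with every zero λ of H₀ (formed with this K_d) satisfying Re λ ≤ −δ, and (b) every complex eigenvalue of B·K_d·C has real part strictly smaller than 1. -/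
open Matrix

lemma sign_count (k : ℝ → ℕ) : ∀ (S : Finset ℝ) (f : ℝ → ℝ), Continuous f →
    (∀ x, 0 ≤ x → (f x = 0 ↔ x ∈ S)) → (∀ s ∈ S, 0 < s) →
    (∀ s ∈ S, ∃ g : ℝ → ℝ, ContinuousAt g s ∧ g s ≠ 0 ∧
      ∀ᶠ x in nhds s, f x = (x - s) ^ k s * g x) →
    (∀ᶠ x in Filter.atTop, 0 < f x) → 0 < (-1) ^ (∑ s ∈ S, k s) * f 0 := by
  classical
  intro S
  induction S using Finset.induction_on with
  | empty =>
    intro f hf hz _ _ hpos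
    simp only [Finset.sum_empty, pow_zero, one_mul]
    obtain ⟨R, hR1, hR2⟩ := (hpos.and (Filter.eventually_ge_atTop 0)).exists
    by_contra hcon
    push Not at hcon
    obtain ⟨c, hc, hc0⟩ := intermediate_value_Icc hR2 hf.continuousOn ⟨hcon, hR1.le⟩
    simpa using (hz c hc.1).1 hc0
  | insert a S ha ih =>
    intro f hf hz hS hloc hpos
    obtain ⟨g, hg, hga, hgf⟩ := hloc a (by simp)
    have ha0 : 0 < a := hS a (by simp)
    set f' : ℝ → ℝ := Function.update (fun x => f x / (x - a) ^ k a) a (g a) with hf'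
    have hne : ∀ x, x ≠ a → f' x = f x / (x - a) ^ k a := fun x hx => by
      simp [hf', Function.update_of_ne hx]
    have haa : f' a = g a := by simp [hf']
    have hnear : f' =ᶠ[nhds a] g := by
      filter_upwards [hgf] with x hx
      by_cases h : x = a
      · rw [h, haa]
      · rw [hne x h, hx]
        have : x - a ≠ 0 := sub_ne_zero.2 h
        field_simp
    have heq : ∀ b, b ≠ a → f' =ᶠ[nhds b] fun x => f x / (x - a) ^ k a := fun b hb => by
      filter_upwards [isOpen_ne.mem_nhds hb] with x hx using hne x hx
    have hcont : Continuous f' := by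
      rw [continuous_iff_continuousAt]
      intro b
      by_cases hb : b = a
      · subst hb
        exact hg.congr hnear.symm
      · refine ContinuousAt.congr ?_ (heq b hb).symm
        exact hf.continuousAt.div (by fun_prop) (pow_ne_zero _ (sub_ne_zero.2 hb))
    have key := ih f' hcont ?_ ?_ ?_ ?_
    · rw [hne 0 ha0.ne] at key
      rw [Finset.sum_insert ha]
      have hp : 0 < a ^ k a := by positivity
      have e : (0 - a) ^ k a = (-1) ^ k a * a ^ k a := by rw [← mul_pow]; ring
      have h1 : ((-1 : ℝ) ^ k a) * (-1) ^ k a = 1 := by rw [← mul_pow]; simp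
      have h2 : f 0 = f 0 / (0 - a) ^ k a * ((-1) ^ k a * a ^ k a) := by
        rw [← e]
        have : (0 - a) ^ k a ≠ 0 := pow_ne_zero _ (by linarith)
        field_simp
      rw [h2, pow_add]
      calc 0 < ((-1) ^ (∑ s ∈ S, k s) * (f 0 / (0 - a) ^ k a)) * a ^ k a := mul_pos key hp
        _ = ((-1) ^ (∑ s ∈ S, k s) * (f 0 / (0 - a) ^ k a)) * a ^ k a * (((-1 : ℝ) ^ k a) * (-1) ^ k a) := by
          rw [h1, mul_one]
        _ = _ := by ring
    · intro x hx
      by_cases h : x = a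
      · subst h
        simp [haa, hga, ha]
      · have : x - a ≠ 0 := sub_ne_zero.2 h
        rw [hne x h, div_eq_zero_iff, hz x hx]
        simp [h, this]
    · intro s hs
      exact hS s (by simp [hs])
    · intro s hs
      have hsa : s ≠ a := fun h => ha (h ▸ hs)
      obtain ⟨g1, h1, h2, h3⟩ := hloc s (by simp [hs])
      refine ⟨fun x => g1 x / (x - a) ^ k a, ?_, ?_, ?_⟩
      · exact h1.div (by fun_prop) (pow_ne_zero _ (sub_ne_zero.2 hsa))
      · exact div_ne_zero h2 (pow_ne_zero _ (sub_ne_zero.2 hsa))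
      · filter_upwards [h3, heq s hsa] with x hx hx2
        rw [hx2, hx, mul_div_assoc]
    · filter_upwards [hpos, Filter.eventually_gt_atTop a] with x hx hxa
      rw [hne x hxa.ne']
      exact div_pos hx (pow_pos (by linarith) _)

lemma H0_conj {n m p q K : ℕ}
    (A0 : Matrix (Fin n) (Fin n) ℝ) (A : Fin K → Matrix (Fin n) (Fin n) ℝ)
    (τ : Fin K → ℝ)
    (B : Matrix (Fin n) (Fin m) ℝ) (C : Matrix (Fin p) (Fin n) ℝ)
    (Kp Kd : Matrix (Fin m) (Fin p) ℝ)
    (Ui : Matrix (Fin m) (Fin q) ℝ) (Vi : Matrix (Fin q) (Fin p) ℝ)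
    (z : ℂ) : H0 A0 A τ B C Kp Kd Ui Vi (starRingEnd ℂ z) =
      starRingEnd ℂ (H0 A0 A τ B C Kp Kd Ui Vi z) := by
  unfold H0
  rw [RingHom.map_det]
  congr 1
  ext i j
  rcases i with i | i <;> rcases j with j | j <;>
    simp [Matrix.sum_apply, Matrix.mul_apply, cM, ← Complex.exp_conj, Matrix.one_apply, apply_ite]
  split_ifs <;> simp_all

lemma H0_cont {n m p q K : ℕ}
    (A0 : Matrix (Fin n) (Fin n) ℝ) (A : Fin K → Matrix (Fin n) (Fin n) ℝ)
    (τ : Fin K → ℝ)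
    (B : Matrix (Fin n) (Fin m) ℝ) (C : Matrix (Fin p) (Fin n) ℝ)
    (Kp Kd : Matrix (Fin m) (Fin p) ℝ)
    (Ui : Matrix (Fin m) (Fin q) ℝ) (Vi : Matrix (Fin q) (Fin p) ℝ) :
    Continuous (H0 A0 A τ B C Kp Kd Ui Vi) := by
  unfold H0
  apply Continuous.matrix_det
  fun_prop

lemma H0_pos {n m p q K : ℕ}
    (A0 : Matrix (Fin n) (Fin n) ℝ) (A : Fin K → Matrix (Fin n) (Fin n) ℝ)
    (τ : Fin K → ℝ) (hτ : ∀ k, 0 < τ k)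
    (B : Matrix (Fin n) (Fin m) ℝ) (C : Matrix (Fin p) (Fin n) ℝ)
    (Kp Kd : Matrix (Fin m) (Fin p) ℝ)
    (Ui : Matrix (Fin m) (Fin q) ℝ) (Vi : Matrix (Fin q) (Fin p) ℝ)
    (hd : 0 < (1 - cM B * cM Kd * cM C).det.re) :
    ∀ᶠ x : ℝ in Filter.atTop, 0 < (H0 A0 A τ B C Kp Kd Ui Vi x).re := by
  set E := Matrix.fromBlocks (1 - cM B * cM Kd * cM C) 0 0 (1 : Matrix (Fin q) (Fin q) ℂ) with hE
  set M := Matrix.fromBlocks (cM A0 + cM B * cM Kp * cM C) (cM B * cM Ui) (cM Vi * cM C) 0 with hM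
  have hdE : E.det = (1 - cM B * cM Kd * cM C).det := by
    rw [hE, Matrix.det_fromBlocks_zero₂₁]; simp
  have hinv : Filter.Tendsto (fun x : ℝ => ((x⁻¹ : ℝ) : ℂ)) Filter.atTop (nhds 0) := by
    have := (Complex.continuous_ofReal.tendsto 0).comp tendsto_inv_atTop_zero
    simpa [Function.comp_def] using this
  have hexp : ∀ k, Filter.Tendsto (fun x : ℝ => Complex.exp (-(x:ℂ) * (τ k : ℂ))) Filter.atTop (nhds 0) := by
    intro k
    have h1 : Filter.Tendsto (fun x : ℝ => Real.exp (-(x * τ k))) Filter.atTop (nhds 0) :=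
      Real.tendsto_exp_neg_atTop_nhds_zero.comp (Filter.tendsto_id.atTop_mul_const (hτ k))
    have := (Complex.continuous_ofReal.tendsto 0).comp h1
    simpa [Function.comp_def] using this
  set N : ℝ → Matrix (Fin n ⊕ Fin q) (Fin n ⊕ Fin q) ℂ := fun x =>
    E - ((x⁻¹ : ℝ) : ℂ) • (M + ∑ k : Fin K, Complex.exp (-(x:ℂ) * (τ k : ℂ)) •
        Matrix.fromBlocks (cM (A k)) 0 0 (0 : Matrix (Fin q) (Fin q) ℂ)) with hN
  have hNt : Filter.Tendsto N Filter.atTop (nhds E) := by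
    have h2 := tendsto_finsetSum (Finset.univ : Finset (Fin K)) (fun k _ => (hexp k).smul_const
      (Matrix.fromBlocks (cM (A k)) 0 0 (0 : Matrix (Fin q) (Fin q) ℂ)))
    have := (tendsto_const_nhds (x := E)).sub (hinv.smul ((tendsto_const_nhds (x := M)).add h2))
    simp only [zero_smul, sub_zero] at this
    exact this
  have hdet : Filter.Tendsto (fun x => (N x).det.re) Filter.atTop (nhds E.det.re) := by
    have hc : Continuous (fun X : Matrix (Fin n ⊕ Fin q) (Fin n ⊕ Fin q) ℂ => X.det.re) :=
      Complex.continuous_re.comp (Continuous.matrix_det continuous_id)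
    exact (hc.tendsto E).comp hNt
  rw [hdE] at hdet
  filter_upwards [hdet.eventually (lt_mem_nhds hd), Filter.eventually_gt_atTop 0] with x hx hx0
  have : H0 A0 A τ B C Kp Kd Ui Vi x = ((x : ℝ) : ℂ) ^ (n + q) * (N x).det := by
    have hx0' : (x : ℂ) ≠ 0 := by exact_mod_cast hx0.ne'
    have := Matrix.det_smul (N x) (x : ℂ)
    rw [Fintype.card_sum, Fintype.card_fin, Fintype.card_fin] at this
    rw [← this]
    unfold H0
    congr 1
    rw [hN]
    simp only [smul_sub, smul_smul, Complex.ofReal_inv, mul_inv_cancel₀ hx0', one_smul]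
    rw [sub_sub]
  rw [this, ← Complex.ofReal_pow, Complex.re_ofReal_mul]
  positivity

lemma det_pos {n : ℕ} (M : Matrix (Fin n) (Fin n) ℝ)
    (h : ∀ μ : ℂ, (μ • (1 : Matrix (Fin n) (Fin n) ℂ) - cM M).det = 0 → μ.re < 1) :
    0 < (1 - cM M).det.re := by
  have hreal : ∀ t : ℝ, (1 - (t : ℂ) • cM M).det = (((1 - t • M).det : ℝ) : ℂ) := by
    intro t
    have := RingHom.map_det Complex.ofRealHom (1 - t • M)
    rw [Complex.ofRealHom_eq_coe] at this
    rw [this]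
    congr 1
    ext i j
    simp [cM, Matrix.one_apply, apply_ite]
  have h1 := hreal 1
  simp only [Complex.ofReal_one, one_smul] at h1
  rw [h1, Complex.ofReal_re]
  by_contra hcon
  push Not at hcon
  have hc : Continuous (fun t : ℝ => (1 - t • M).det) := Continuous.matrix_det (by fun_prop)
  obtain ⟨t, ht, ht0⟩ := intermediate_value_Icc' (zero_le_one) hc.continuousOn
    (show (0:ℝ) ∈ Set.Icc _ _ from ⟨by simpa using hcon, by simp⟩)
  simp only at ht0
  have htne : t ≠ 0 := by rintro rfl; simp at ht0
  have htpos : 0 < t := lt_of_le_of_ne ht.1 htne.symm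
  have h2 := hreal t
  rw [ht0, Complex.ofReal_zero] at h2
  have htc : (t : ℂ) ≠ 0 := by exact_mod_cast htne
  have h3 : (1 - (t : ℂ) • cM M) = (t : ℂ) • (((t⁻¹ : ℝ) : ℂ) • (1 : Matrix (Fin n) (Fin n) ℂ) - cM M) := by
    rw [smul_sub, smul_smul, Complex.ofReal_inv, mul_inv_cancel₀ htc, one_smul]
  rw [h3, Matrix.det_smul] at h2
  have h4 := h _ ((mul_eq_zero.1 h2).resolve_left (pow_ne_zero _ htc))
  rw [Complex.ofReal_re] at h4
  have := (one_le_inv₀ htpos).2 ht.2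
  linarith

lemma order_conj (F : ℂ → ℂ) (hF : ∀ z, AnalyticAt ℂ F z)
    (hconj : ∀ z, F (starRingEnd ℂ z) = starRingEnd ℂ (F z))
    (hfo : ∀ z, analyticOrderAt F z ≠ ⊤) (z : ℂ) :
    analyticOrderAt F (starRingEnd ℂ z) = analyticOrderAt F z := by
  obtain ⟨g, hg, hg0, hgF⟩ := (hF z).analyticOrderAt_ne_top.1 (hfo z)
  rw [← ENat.natCast_toNat_eq_self.2 (hfo z), (hF _).analyticOrderAt_eq_natCast]
  refine ⟨fun w => starRingEnd ℂ (g (starRingEnd ℂ w)), ?_, ?_, ?_⟩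
  · rw [Complex.analyticAt_iff_eventually_differentiableAt] at hg ⊢
    have hc : Filter.Tendsto (starRingEnd ℂ) (nhds (starRingEnd ℂ z)) (nhds z) := by
      simpa using (Complex.continuous_conj.tendsto (starRingEnd ℂ z))
    filter_upwards [hc.eventually hg] with w hw
    have := hw.conj_conj
    simpa [Function.comp_def] using this
  · simpa using hg0
  · have hc : Filter.Tendsto (starRingEnd ℂ) (nhds (starRingEnd ℂ z)) (nhds z) := by
      simpa using (Complex.continuous_conj.tendsto (starRingEnd ℂ z))
    filter_upwards [hc.eventually hgF] with w hw
    rw [hconj] at hw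
    have := congrArg (starRingEnd ℂ) hw
    simpa [analyticOrderNatAt] using this

lemma neg_of_odd (F : ℂ → ℂ) (hF : ∀ z, AnalyticAt ℂ F z)
    (hconj : ∀ z, F (starRingEnd ℂ z) = starRingEnd ℂ (F z))
    (hne : ∃ z, F z ≠ 0) (h0 : F 0 ≠ 0)
    (hfin : Set.Finite {z : ℂ | 0 ≤ z.re ∧ F z = 0})
    (hodd : Odd (∑ z ∈ hfin.toFinset, (analyticOrderAt F z).toNat))
    (hpos : ∀ᶠ x : ℝ in Filter.atTop, 0 < (F x).re) : (F 0).re < 0 := by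
  classical
  have hfo : ∀ z, analyticOrderAt F z ≠ ⊤ := by
    intro z
    obtain ⟨w, hw⟩ := hne
    refine AnalyticOnNhd.analyticOrderAt_ne_top_of_isPreconnected (U := Set.univ) (x := w)
      (fun z _ => hF z) isPreconnected_univ trivial trivial ?_
    rw [(hF w).analyticOrderAt_eq_zero.2 hw]
    simp
  have hreal : ∀ x : ℝ, (F x).im = 0 := by
    intro x
    have := hconj x
    rw [Complex.conj_ofReal] at this
    exact Complex.conj_eq_iff_im.1 this.symm
  have hzero : ∀ x : ℝ, (F x).re = 0 ↔ F x = 0 := by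
    intro x
    constructor
    · intro h
      exact Complex.ext h (hreal x)
    · intro h
      simp [h]
  set Z := hfin.toFinset with hZ
  have hmem : ∀ z, z ∈ Z ↔ 0 ≤ z.re ∧ F z = 0 := by intro z; simp [hZ]
  set k : ℝ → ℕ := fun s => (analyticOrderAt F (s : ℂ)).toNat with hk
  set R := (Z.filter (fun z => z.im = 0)) with hR
  set S : Finset ℝ := R.image Complex.re with hS
  have hmemS : ∀ x : ℝ, x ∈ S ↔ 0 ≤ x ∧ F x = 0 := by
    intro x
    simp only [hS, hR, Finset.mem_image, Finset.mem_filter, hmem]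
    constructor
    · rintro ⟨z, ⟨⟨h1, h2⟩, h3⟩, rfl⟩
      have : ((z.re : ℝ) : ℂ) = z := Complex.ext (by simp) (by simp [h3])
      rw [this]
      exact ⟨h1, h2⟩
    · rintro ⟨h1, h2⟩
      exact ⟨x, ⟨⟨by simpa using h1, h2⟩, by simp⟩, by simp⟩
  have hsumS : ∑ s ∈ S, k s = ∑ z ∈ R, (analyticOrderAt F z).toNat := by
    rw [hS, Finset.sum_image]
    · refine Finset.sum_congr rfl fun z hz => ?_
      have h3 : z.im = 0 := (Finset.mem_filter.1 hz).2
      have : ((z.re : ℝ) : ℂ) = z := Complex.ext (by simp) (by simp [h3])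
      simp only [hk, this]
    · intro z hz w hw h
      have h3 : z.im = 0 := (Finset.mem_filter.1 hz).2
      have h4 : w.im = 0 := (Finset.mem_filter.1 hw).2
      exact Complex.ext h (by rw [h3, h4])
  have heven : ((∑ z ∈ Z.filter (fun z => ¬ z.im = 0), (analyticOrderAt F z).toNat : ℕ) : ZMod 2)
      = 0 := by
    push_cast
    refine Finset.sum_involution (fun z _ => starRingEnd ℂ z) ?_ ?_ ?_ ?_
    · intro z _
      rw [order_conj F hF hconj hfo]
      exact CharTwo.add_self_eq_zero _
    · intro z hz _ h
      exact (Finset.mem_filter.1 hz).2 (Complex.conj_eq_iff_im.1 h)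
    · intro z hz
      simp only [Finset.mem_filter, hmem, hconj] at hz ⊢
      simpa using hz
    · intro z _
      simp
  have hoddS : Odd (∑ s ∈ S, k s) := by
    rw [hsumS]
    rw [← ZMod.natCast_eq_one_iff_odd] at hodd ⊢
    rw [← Finset.sum_filter_add_sum_filter_not Z (fun z => z.im = 0)] at hodd
    rw [Nat.cast_add, heven, add_zero] at hodd
    exact hodd
  have hcF : Continuous F := continuous_iff_continuousAt.2 fun z => (hF z).continuousAt
  have key := sign_count k S (fun x => (F x).re)
    (Complex.continuous_re.comp (hcF.comp Complex.continuous_ofReal)) ?_ ?_ ?_ hpos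
  · rw [hoddS.neg_one_pow] at key
    simp only [Complex.ofReal_zero] at key
    linarith
  · intro x hx
    rw [hzero, hmemS]
    simp [hx]
  · intro s hs
    rw [hmemS] at hs
    refine lt_of_le_of_ne hs.1 ?_
    rintro rfl
    exact h0 (by simpa using hs.2)
  · intro s _
    obtain ⟨g, hg, hg0, hgF⟩ := (hF s).analyticOrderAt_ne_top.1 (hfo s)
    have hco : Filter.Tendsto (fun x : ℝ => (x : ℂ)) (nhds s) (nhds (s : ℂ)) :=
      Complex.continuous_ofReal.tendsto s
    have hgc : ContinuousAt (fun x : ℝ => g x) s :=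
      ContinuousAt.comp (g := g) (f := fun x : ℝ => (x : ℂ)) hg.continuousAt hco
    have hev : ∀ᶠ x : ℝ in nhds s, F x = (((x - s) ^ k s : ℝ) : ℂ) * g x := by
      filter_upwards [hco.eventually hgF] with x hx
      rw [hx]
      simp [hk, analyticOrderNatAt]
    have him : (g s).im = 0 := by
      have h1 : Filter.Tendsto (fun x : ℝ => (g x).im) (nhdsWithin s {s}ᶜ) (nhds (g s).im) :=
        ((Complex.continuous_im.tendsto _).comp hgc.tendsto).mono_left nhdsWithin_le_nhds
      have h2 : Filter.Tendsto (fun x : ℝ => (g x).im) (nhdsWithin s {s}ᶜ) (nhds 0) := by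
        refine tendsto_const_nhds.congr' ?_
        filter_upwards [nhdsWithin_le_nhds hev, self_mem_nhdsWithin] with x hx hxs
        have h3 := hreal x
        rw [hx, Complex.im_ofReal_mul] at h3
        exact ((mul_eq_zero.1 h3).resolve_left (pow_ne_zero _ (sub_ne_zero.2 hxs))).symm
      exact tendsto_nhds_unique h1 h2
    refine ⟨fun x => (g x).re, Complex.continuous_re.continuousAt.comp hgc, ?_, ?_⟩
    · intro h
      exact hg0 (Complex.ext h him)
    · filter_upwards [hev] with x hx
      rw [hx, Complex.re_ofReal_mul]

/-- Proposition 4.4 (odd-number limitation): if, with zero derivative gain, the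
nominal characteristic function has an odd total number of zeros (counted with
multiplicity) in the closed right half-plane, then no derivative gain `K_d`
simultaneously achieves exponential stability of the nominal closed loop and the
Hurwitz property of `B·K_d·C − Iₙ`. -/
theorem stmt10 {n m p q K : ℕ}
    (hn : 0 < n) (hm : 0 < m) (hp : 0 < p) (hK : 0 < K)
    (A0 : Matrix (Fin n) (Fin n) ℝ) (A : Fin K → Matrix (Fin n) (Fin n) ℝ)
    (τ : Fin K → ℝ) (hτpos : ∀ k, 0 < τ k) (hτmono : StrictMono τ)
    (B : Matrix (Fin n) (Fin m) ℝ) (hB : B.rank = m)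
    (C : Matrix (Fin p) (Fin n) ℝ) (hC : C.rank = p)
    (Kp Ki : Matrix (Fin m) (Fin p) ℝ)
    (Ui : Matrix (Fin m) (Fin q) ℝ) (Vi : Matrix (Fin q) (Fin p) ℝ)
    (hfact : Ki = Ui * Vi) (hUi : Ui.rank = q) (hVi : Vi.rank = q) (hKi : Ki.rank = q)
    (hne : ∃ z : ℂ, H0 A0 A τ B C Kp 0 Ui Vi z ≠ 0)
    (hanal : ∀ z : ℂ, AnalyticAt ℂ (H0 A0 A τ B C Kp 0 Ui Vi) z)
    (hfin : Set.Finite {z : ℂ | 0 ≤ z.re ∧ H0 A0 A τ B C Kp 0 Ui Vi z = 0})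
    (hodd : Odd (∑ z ∈ hfin.toFinset, (analyticOrderAt (H0 A0 A τ B C Kp 0 Ui Vi) z).toNat)) :
    ¬ ∃ Kd : Matrix (Fin m) (Fin p) ℝ,
      (∃ δ : ℝ, 0 < δ ∧ ∀ lam : ℂ,
        H0 A0 A τ B C Kp Kd Ui Vi lam = 0 → lam.re ≤ -δ) ∧
      (∀ μ : ℂ,
        (μ • (1 : Matrix (Fin n) (Fin n) ℂ) - cM B * cM Kd * cM C).det = 0 → μ.re < 1) := by
  rintro ⟨Kd, ⟨δ, hδ, hst⟩, hhur⟩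
  have hz : H0 A0 A τ B C Kp Kd Ui Vi 0 = H0 A0 A τ B C Kp 0 Ui Vi 0 := by
    simp [H0]
  have hmul : cM B * cM Kd * cM C = cM (B * Kd * C) := by
    ext i j
    simp [cM, Matrix.mul_apply]
  have hcM0 : cM (0 : Matrix (Fin m) (Fin p) ℝ) = 0 := by
    ext i j
    simp [cM]
  have hd : 0 < (1 - cM B * cM Kd * cM C).det.re := by
    rw [hmul] at hhur ⊢
    exact det_pos _ hhur
  have hneg : (H0 A0 A τ B C Kp 0 Ui Vi 0).re < 0 := by
    refine neg_of_odd _ hanal (H0_conj A0 A τ B C Kp 0 Ui Vi) hne ?_ hfin hodd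
      (H0_pos A0 A τ hτpos B C Kp 0 Ui Vi (by simp [hcM0]))
    intro h
    have := hst 0 (hz.trans h)
    simp at this
    linarith
  rw [← hz] at hneg
  obtain ⟨R, hR, hR0⟩ := ((H0_pos A0 A τ hτpos B C Kp Kd Ui Vi hd).and
    (Filter.eventually_ge_atTop 0)).exists
  have hc : Continuous (fun x : ℝ => (H0 A0 A τ B C Kp Kd Ui Vi x).re) :=
    Complex.continuous_re.comp ((H0_cont A0 A τ B C Kp Kd Ui Vi).comp Complex.continuous_ofReal)
  obtain ⟨c, hc1, hc2⟩ := intermediate_value_Icc hR0 hc.continuousOn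
    (show (0 : ℝ) ∈ Set.Icc _ _ from ⟨by simpa using hneg.le, hR.le⟩)
  have him : (H0 A0 A τ B C Kp Kd Ui Vi c).im = 0 := by
    have := H0_conj A0 A τ B C Kp Kd Ui Vi c
    rw [Complex.conj_ofReal] at this
    exact Complex.conj_eq_iff_im.1 this.symm
  have := hst c (Complex.ext hc2 him)
  rw [Complex.ofReal_re] at this
  linarith [hc1.1]
end

section
/- (Necessity of ρ(B·K_d·C) < 1 under input delay.) Let τ_u > 0. If the input-delayed nominal closed loop is exponentially stable, i.e. there exists δ > 0 such that every λ ∈ ℂ with H^{τ_u}(λ) = 0 satisfies Re λ ≤ −δ, then the spectral radius of B·K_d·C (the maximum of |μ| over the complex eigenvalues μ of B·K_d·C) is strictly smaller than 1. -/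
open Matrix

/-- The nominal characteristic function `H^{τᵤ}` of the closed loop with input
delay `τᵤ`. -/
noncomputable def Htau {n m p q K : ℕ}
    (A0 : Matrix (Fin n) (Fin n) ℝ) (A : Fin K → Matrix (Fin n) (Fin n) ℝ)
    (τ : Fin K → ℝ) (τu : ℝ)
    (B : Matrix (Fin n) (Fin m) ℝ) (C : Matrix (Fin p) (Fin n) ℝ)
    (Kp Kd : Matrix (Fin m) (Fin p) ℝ)
    (Ui : Matrix (Fin m) (Fin q) ℝ) (Vi : Matrix (Fin q) (Fin p) ℝ)
    (lam : ℂ) : ℂ :=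
  (lam • ((1 : Matrix (Fin n ⊕ Fin q) (Fin n ⊕ Fin q) ℂ)
      - Complex.exp (-lam * (τu : ℂ)) •
          Matrix.fromBlocks (cM B * cM Kd * cM C) 0 0 (0 : Matrix (Fin q) (Fin q) ℂ))
    - Matrix.fromBlocks (cM A0) 0 (cM Vi * cM C) (0 : Matrix (Fin q) (Fin q) ℂ)
    - Complex.exp (-lam * (τu : ℂ)) •
        Matrix.fromBlocks (cM B * cM Kp * cM C) (cM B * cM Ui) 0 (0 : Matrix (Fin q) (Fin q) ℂ)
    - ∑ k : Fin K, Complex.exp (-lam * (τ k : ℂ)) •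
        Matrix.fromBlocks (cM (A k)) 0 0 (0 : Matrix (Fin q) (Fin q) ℂ)).det

theorem hurwitz_aux {K : ℕ} (G : ℂ → ℂ → (Fin K → ℂ) → ℂ)
    (hGc : Continuous (fun x : ℂ × ℂ × (Fin K → ℂ) => G x.1 x.2.1 x.2.2))
    (f : ℂ → ℂ) (hf : ∀ z w, G z 0 w = f z) (hfd : Differentiable ℂ f)
    (hf0 : f 0 = 0) (hfn : ∃ z, f z ≠ 0) (δ : ℝ) (hδ : 0 < δ) :
    ∃ r : ℝ, 0 < r ∧ r < δ ∧ ∃ ε : ℝ, 0 < ε ∧ ∀ (e : ℂ → ℂ) (w : Fin K → ℂ),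
      (∀ k, ‖w k‖ ≤ 1) → (∀ z, ‖z‖ ≤ r → ‖e z‖ < ε) →
      DiffContOnCl ℂ (fun z => G z (e z) w) (Metric.ball 0 r) →
      ∃ z, ‖z‖ ≤ r ∧ G z (e z) w = 0 := by
  have han : AnalyticOnNhd ℂ f Set.univ := fun z _ => hfd.analyticAt z
  have hev : ∀ᶠ z in nhdsWithin (0:ℂ) {0}ᶜ, f z ≠ 0 := by
    rcases (hfd.analyticAt 0).eventually_eq_zero_or_eventually_ne_zero with h | h
    · exfalso
      obtain ⟨z, hz⟩ := hfn
      apply hz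
      have := han.eqOn_zero_of_preconnected_of_eventuallyEq_zero isPreconnected_univ
        (Set.mem_univ 0) h
      exact this (Set.mem_univ z)
    · exact h
  rw [eventually_nhdsWithin_iff, Metric.eventually_nhds_iff] at hev
  obtain ⟨ρ, hρ, hev⟩ := hev
  obtain ⟨r, hr0, hr⟩ : ∃ r, 0 < r ∧ r < min ρ δ := exists_between (lt_min hρ hδ)
  have hrρ := hr.trans_le (min_le_left _ _)
  have hrδ := hr.trans_le (min_le_right _ _)
  refine ⟨r, hr0, hrδ, ?_⟩
  have hsph : ∀ z ∈ Metric.sphere (0:ℂ) r, f z ≠ 0 := by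
    intro z hz
    have hz' : ‖z‖ = r := by simpa using hz
    apply hev (by simpa [hz'] using hrρ)
    intro h
    have h0 : z = 0 := h
    rw [h0] at hz'
    simp at hz'
    linarith
  obtain ⟨c, hc, hcm⟩ : ∃ c : ℝ, 0 < c ∧ ∀ z ∈ Metric.sphere (0:ℂ) r, c ≤ ‖f z‖ := by
    have hne : (Metric.sphere (0:ℂ) r).Nonempty := NormedSpace.sphere_nonempty.2 hr0.le
    obtain ⟨z0, hz0, hmin⟩ := (isCompact_sphere (0:ℂ) r).exists_isMinOn hne
      hfd.continuous.norm.continuousOn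
    exact ⟨‖f z0‖, norm_pos_iff.2 (hsph z0 hz0), fun z hz => hmin hz⟩
  set S : Set (ℂ × ℂ × (Fin K → ℂ)) :=
    Metric.closedBall 0 r ×ˢ Metric.closedBall 0 1 ×ˢ Metric.closedBall 0 1 with hS
  have hScomp : IsCompact S :=
    (isCompact_closedBall _ _).prod ((isCompact_closedBall _ _).prod (isCompact_closedBall _ _))
  have huc := hScomp.uniformContinuousOn_of_continuous hGc.continuousOn
  rw [Metric.uniformContinuousOn_iff] at huc
  obtain ⟨ε, hε, huc⟩ := huc (c/3) (by positivity)
  have key : ∀ z e (w : Fin K → ℂ), ‖z‖ ≤ r → ‖e‖ < min ε 1 → (∀ k, ‖w k‖ ≤ 1) →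
      ‖G z e w - f z‖ < c/3 := by
    intro z e w hz he hw
    have hw' : ‖w‖ ≤ 1 := (pi_norm_le_iff_of_nonneg zero_le_one).2 hw
    have := huc (z, e, w) (by
        simp only [hS, Set.mem_prod, mem_closedBall_zero_iff]
        exact ⟨hz, (he.trans_le (min_le_right _ _)).le, hw'⟩) (z, 0, w) (by
        simp only [hS, Set.mem_prod, mem_closedBall_zero_iff]
        exact ⟨hz, by simp, hw'⟩) (by
        simp only [Prod.dist_eq, dist_self, dist_zero_right]
        have := he.trans_le (min_le_left _ _)
        simp [this, hε])
    simpa [dist_eq_norm, hf] using this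
  refine ⟨min ε 1, lt_min hε one_pos, ?_⟩
  intro e w hw he hdiff
  by_contra! hcon
  have hcl : closure (Metric.ball (0:ℂ) r) = Metric.closedBall 0 r := closure_ball _ hr0.ne'
  have hinv : DiffContOnCl ℂ (fun z => (G z (e z) w)⁻¹) (Metric.ball 0 r) := by
    apply hdiff.inv
    intro z hz
    rw [hcl] at hz
    exact hcon z (by simpa using hz)
  have hmax := Complex.norm_le_of_forall_mem_frontier_norm_le (C := (2*c/3)⁻¹)
    Metric.isBounded_ball hinv (by
      intro z hz
      rw [frontier_ball _ hr0.ne'] at hz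
      have hz' : ‖z‖ = r := by simpa using hz
      have h1 := key z (e z) w hz'.le (he z hz'.le) hw
      have h2 := hcm z hz
      have h3 := norm_sub_norm_le (f z) (G z (e z) w)
      rw [norm_sub_rev] at h3
      rw [norm_inv]
      apply inv_anti₀ (by positivity)
      linarith) (z := 0) (by rw [hcl]; simp [hr0.le])
  have h1 := key 0 (e 0) w (by simpa using hr0.le) (he 0 (by simpa using hr0.le)) hw
  rw [hf0, sub_zero] at h1
  have hpos : 0 < ‖G 0 (e 0) w‖ := norm_pos_iff.2 (hcon 0 (by simpa using hr0.le))
  simp only [norm_inv] at hmax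
  have := (inv_le_inv₀ hpos (by positivity)).1 hmax
  linarith

theorem generic_aux {ι : Type*} [Fintype ι] [DecidableEq ι] {K : ℕ}
    (M N0 N1 : Matrix ι ι ℂ) (N : Fin K → Matrix ι ι ℂ) (τ : Fin K → ℝ)
    (hτ : ∀ k, 0 < τ k) (τu : ℝ) (hτu : 0 < τu) (μ : ℂ) (hμ : 1 ≤ ‖μ‖)
    (hdet : (1 - μ⁻¹ • M).det = 0) (δ : ℝ) (hδ : 0 < δ) :
    ∃ lam : ℂ, -δ < lam.re ∧
      (lam • (1 - Complex.exp (-lam * (τu : ℂ)) • M) - N0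
        - Complex.exp (-lam * (τu : ℂ)) • N1
        - ∑ k : Fin K, Complex.exp (-lam * (τ k : ℂ)) • N k).det = 0 := by
  have hμ0 : μ ≠ 0 := by rintro rfl; simp at hμ; linarith
  let D : ℂ → ℂ → (Fin K → ℂ) → Matrix ι ι ℂ := fun z e w =>
    1 - (Complex.exp (-z * τu) * μ⁻¹) • M - e • (N0 + (Complex.exp (-z * τu) * μ⁻¹) • N1
      + ∑ k, (w k * Complex.exp (-z * τ k)) • N k)
  have hDc : Continuous (fun x : ℂ × ℂ × (Fin K → ℂ) => D x.1 x.2.1 x.2.2) := by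
    simp only [D]; fun_prop
  have hDd : ∀ (s : Set ℂ) (e : ℂ → ℂ) w, DifferentiableOn ℂ e s →
      DifferentiableOn ℂ (fun z => (D z (e z) w).det) s := by
    intro s e w he
    simp only [D, Matrix.det_apply, Matrix.sub_apply, Matrix.add_apply, Matrix.smul_apply,
      Matrix.sum_apply, smul_eq_mul, Units.smul_def, zsmul_eq_mul]
    fun_prop
  have hfn : ∃ z, (D z 0 0).det ≠ 0 := by
    have hc : Continuous (fun s : ℂ => (1 - (s * μ⁻¹) • M).det) := by
      apply Continuous.matrix_det; fun_prop
    have hev : ∀ᶠ s in nhds (0:ℂ), (1 - (s * μ⁻¹) • M).det ≠ 0 :=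
      hc.continuousAt.eventually_ne (by simp)
    have ht : Filter.Tendsto (fun t : ℝ => Complex.exp (-(t:ℂ) * τu)) Filter.atTop (nhds 0) := by
      rw [tendsto_zero_iff_norm_tendsto_zero]
      have : ∀ t : ℝ, ‖Complex.exp (-(t:ℂ) * τu)‖ = Real.exp (-(t * τu)) := by
        intro t; rw [Complex.norm_exp]; simp
      simp only [this]
      exact Real.tendsto_exp_neg_atTop_nhds_zero.comp
        (Filter.tendsto_id.atTop_mul_const hτu)
    obtain ⟨t, ht⟩ := (ht.eventually hev).exists
    exact ⟨t, by simpa [D] using ht⟩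
  obtain ⟨r, hr0, hrδ, ε, hε, H⟩ := hurwitz_aux (fun z e w => (D z e w).det) hDc.matrix_det
    (fun z => (D z 0 0).det) (by intro z w; simp [D])
    (by
      have := hDd Set.univ (fun _ => 0) 0 (by fun_prop)
      exact differentiableOn_univ.1 this)
    (by simpa [D] using hdet) hfn δ hδ
  obtain ⟨k, hk⟩ := exists_nat_gt ((ε⁻¹ + r + 1) * τu + ‖Complex.log μ‖)
  let l : ℂ := (Complex.log μ + k * (2 * Real.pi * Complex.I)) / τu
  have hτc : (τu : ℂ) ≠ 0 := by exact_mod_cast hτu.ne'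
  have hlu : Complex.exp (-l * τu) = μ⁻¹ := by
    have : -l * τu = -(Complex.log μ + k * (2 * Real.pi * Complex.I)) := by
      simp only [l]; field_simp
    rw [this, Complex.exp_neg, Complex.exp_add, Complex.exp_log hμ0,
      Complex.exp_nat_mul_two_pi_mul_I, mul_one]
  have hlre : 0 ≤ l.re := by
    simp only [l, Complex.div_ofReal_re]
    apply div_nonneg _ hτu.le
    simp [Complex.log_re]
    exact Real.log_nonneg hμ
  have hln : ε⁻¹ + r + 1 < ‖l‖ := by
    simp only [l, norm_div, Complex.norm_real, Real.norm_eq_abs, abs_of_pos hτu]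
    rw [lt_div_iff₀ hτu]
    have h1 : ‖(k:ℂ) * (2 * Real.pi * Complex.I)‖ = k * (2 * Real.pi) := by
      simp [abs_of_pos Real.pi_pos]
    have h2 := norm_sub_le_norm_add ((k:ℂ) * (2 * Real.pi * Complex.I)) (Complex.log μ)
    rw [add_comm, h1] at h2
    have h3 : (k:ℝ) ≤ k * (2 * Real.pi) :=
      le_mul_of_one_le_right (Nat.cast_nonneg k) (by linarith [Real.pi_gt_three])
    linarith
  have hzl : ∀ z : ℂ, ‖z‖ ≤ r → ε⁻¹ < ‖z + l‖ := by
    intro z hz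
    have := norm_sub_le_norm_add l z
    rw [add_comm] at this
    linarith
  have hεi : 0 < ε⁻¹ := inv_pos.2 hε
  have hzl0 : ∀ z : ℂ, ‖z‖ ≤ r → z + l ≠ 0 := by
    intro z hz h
    have := hzl z hz
    rw [h, norm_zero] at this
    linarith
  obtain ⟨z, hz, hzero⟩ := H (fun z => (z + l)⁻¹) (fun j => Complex.exp (-l * τ j))
    (by
      intro j
      rw [Complex.norm_exp, Real.exp_le_one_iff]
      simp
      exact mul_nonneg hlre (hτ j).le)
    (by
      intro z hz
      rw [norm_inv]
      exact inv_lt_of_inv_lt₀ hε (hzl z hz))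
    (by
      apply DifferentiableOn.diffContOnCl
      rw [closure_ball _ hr0.ne']
      apply hDd
      apply DifferentiableOn.inv (by fun_prop)
      intro z hz
      exact hzl0 z (by simpa using hz))
  refine ⟨z + l, ?_, ?_⟩
  · have := Complex.abs_re_le_norm z
    have := neg_abs_le z.re
    simp only [Complex.add_re]
    linarith
  · have he : ∀ t : ℝ, Complex.exp (-(z + l) * t) = Complex.exp (-z * t) * Complex.exp (-l * t) := by
      intro t; rw [← Complex.exp_add]; congr 1; ring
    have hz0 := hzl0 z hz
    have hEq : ((z + l) • (1 - Complex.exp (-(z + l) * (τu : ℂ)) • M) - N0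
        - Complex.exp (-(z + l) * (τu : ℂ)) • N1
        - ∑ k : Fin K, Complex.exp (-(z + l) * (τ k : ℂ)) • N k)
        = (z + l) • D z (z + l)⁻¹ (fun j => Complex.exp (-l * τ j)) := by
      simp only [D, he, hlu]
      rw [smul_sub (z + l) _ ((z + l)⁻¹ • _), smul_smul, mul_inv_cancel₀ hz0, one_smul]
      simp only [mul_comm (Complex.exp (-l * _))]
      abel
    rw [hEq, Matrix.det_smul, hzero, mul_zero]

/-- Necessity of `ρ(B·K_d·C) < 1` under input delay: if the input-delayed nominal
closed loop is exponentially stable, then every eigenvalue of `B·K_d·C` has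
modulus strictly smaller than `1`. -/
theorem stmt12 {n m p q K : ℕ}
    (hn : 0 < n) (hm : 0 < m) (hp : 0 < p) (hK : 0 < K)
    (A0 : Matrix (Fin n) (Fin n) ℝ) (A : Fin K → Matrix (Fin n) (Fin n) ℝ)
    (τ : Fin K → ℝ) (hτpos : ∀ k, 0 < τ k) (hτmono : StrictMono τ)
    (τu : ℝ) (hτu : 0 < τu)
    (B : Matrix (Fin n) (Fin m) ℝ) (hB : B.rank = m)
    (C : Matrix (Fin p) (Fin n) ℝ) (hC : C.rank = p)
    (Kp Kd Ki : Matrix (Fin m) (Fin p) ℝ)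
    (Ui : Matrix (Fin m) (Fin q) ℝ) (Vi : Matrix (Fin q) (Fin p) ℝ)
    (hfact : Ki = Ui * Vi) (hUi : Ui.rank = q) (hVi : Vi.rank = q) (hKi : Ki.rank = q)
    (hstab : ∃ δ : ℝ, 0 < δ ∧ ∀ lam : ℂ,
      Htau A0 A τ τu B C Kp Kd Ui Vi lam = 0 → lam.re ≤ -δ) :
    ∀ μ : ℂ, (μ • (1 : Matrix (Fin n) (Fin n) ℂ) - cM B * cM Kd * cM C).det = 0 →
      ‖μ‖ < 1 := by
  intro μ hμ
  by_contra! hcon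
  obtain ⟨δ, hδ, hst⟩ := hstab
  have hμ0 : μ ≠ 0 := by rintro rfl; simp at hcon; linarith
  obtain ⟨lam, h1, h2⟩ := generic_aux
    (Matrix.fromBlocks (cM B * cM Kd * cM C) 0 0 (0 : Matrix (Fin q) (Fin q) ℂ))
    (Matrix.fromBlocks (cM A0) 0 (cM Vi * cM C) (0 : Matrix (Fin q) (Fin q) ℂ))
    (Matrix.fromBlocks (cM B * cM Kp * cM C) (cM B * cM Ui) 0 (0 : Matrix (Fin q) (Fin q) ℂ))
    (fun k => Matrix.fromBlocks (cM (A k)) 0 0 (0 : Matrix (Fin q) (Fin q) ℂ))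
    τ hτpos τu hτu μ hcon (by
      rw [← Matrix.fromBlocks_one, Matrix.fromBlocks_smul, sub_eq_add_neg,
        Matrix.fromBlocks_neg, Matrix.fromBlocks_add]
      simp only [smul_zero, neg_zero, add_zero]
      rw [Matrix.det_fromBlocks_zero₂₁, Matrix.det_one, mul_one]
      have : (1 : Matrix (Fin n) (Fin n) ℂ) + -(μ⁻¹ • (cM B * cM Kd * cM C))
          = μ⁻¹ • (μ • (1 : Matrix (Fin n) (Fin n) ℂ) - cM B * cM Kd * cM C) := by
        rw [smul_sub, smul_smul, inv_mul_cancel₀ hμ0, one_smul, sub_eq_add_neg]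
      rw [this, Matrix.det_smul, hμ, mul_zero]) δ hδ
  have := hst lam h2
  linarith
end

section
/- Let M be an n×n complex matrix whose spectral radius (the maximum of |μ| over the complex eigenvalues μ of M) is strictly smaller than 1, and let τ_u > 0. Then there exist ε > 0 and T̂ > 0 such that for every λ ∈ ℂ with Re λ > −ε and every T ∈ (0, T̂), one has λT + 1 ≠ 0 and the matrix Iₙ − (e^{−λτ_u}/(λT + 1))·M is invertible. -/
/-- Input-delay invertibility lemma: if the spectral radius of the `n×n` complex
matrix `M` is `< 1` and `τᵤ > 0`, then there are `ε > 0` and `T̂ > 0` such that for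
all `λ` with `Re λ > −ε` and all `T ∈ (0, T̂)`, `λT + 1 ≠ 0` and
`Iₙ − (e^{−λτᵤ}/(λT+1))·M` is invertible. -/
theorem stmt19 (n : ℕ) (M : Matrix (Fin n) (Fin n) ℂ)
    (hM : ∀ μ : ℂ, (μ • (1 : Matrix (Fin n) (Fin n) ℂ) - M).det = 0 → ‖μ‖ < 1)
    (τu : ℝ) (hτu : 0 < τu) :
    ∃ ε : ℝ, 0 < ε ∧ ∃ That : ℝ, 0 < That ∧
      ∀ lam : ℂ, -ε < lam.re → ∀ T : ℝ, 0 < T → T < That →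
        lam * (T : ℂ) + 1 ≠ 0 ∧
        IsUnit ((1 : Matrix (Fin n) (Fin n) ℂ)
          - (Complex.exp (-lam * (τu : ℂ)) / (lam * (T : ℂ) + 1)) • M) := by
  have hfin : {μ : ℂ | (μ • (1 : Matrix (Fin n) (Fin n) ℂ) - M).det = 0}.Finite := by
    refine (Polynomial.finite_setOf_isRoot (Matrix.charpoly_monic M).ne_zero).subset ?_
    intro μ hμ
    simp only [Set.mem_setOf_eq, Polynomial.IsRoot.def, Matrix.eval_charpoly] at hμ ⊢
    rwa [Matrix.smul_one_eq_diagonal] at hμ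
  obtain ⟨r, hr, hr0, hr1⟩ : ∃ r : ℝ,
      (∀ μ ∈ {μ : ℂ | (μ • (1 : Matrix (Fin n) (Fin n) ℂ) - M).det = 0}, ‖μ‖ < r)
        ∧ 0 < r ∧ r < 1 := by
    have h1 : ∀ᶠ r : ℝ in nhdsWithin 1 (Set.Iio 1),
        ∀ μ ∈ {μ : ℂ | (μ • (1 : Matrix (Fin n) (Fin n) ℂ) - M).det = 0}, ‖μ‖ < r := by
      rw [Filter.eventually_all_finite hfin]
      intro μ hμ
      exact nhdsWithin_le_nhds (lt_mem_nhds (hM μ hμ))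
    have h2 : ∀ᶠ r : ℝ in nhdsWithin 1 (Set.Iio 1), 0 < r :=
      nhdsWithin_le_nhds (lt_mem_nhds one_pos)
    have h3 : ∀ᶠ r : ℝ in nhdsWithin 1 (Set.Iio 1), r < 1 := self_mem_nhdsWithin
    exact (h1.and (h2.and h3)).exists
  set ε : ℝ := (1 - r) / (1 + τu) with hε
  have hεpos : 0 < ε := div_pos (by linarith) (by linarith)
  have hεeq : ε * (1 + τu) = 1 - r := by rw [hε]; field_simp
  have hετ : 0 < ε * τu := mul_pos hεpos hτu
  refine ⟨ε, hεpos, 1, one_pos, ?_⟩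
  intro lam hlam T hT hT1
  have hre : 1 - ε < (lam * (T : ℂ) + 1).re := by
    have : (lam * (T : ℂ) + 1).re = lam.re * T + 1 := by simp
    rw [this]
    nlinarith
  have hne : lam * (T : ℂ) + 1 ≠ 0 := by
    intro h
    rw [h, Complex.zero_re] at hre
    nlinarith
  refine ⟨hne, ?_⟩
  set c : ℂ := Complex.exp (-lam * (τu : ℂ)) / (lam * (T : ℂ) + 1) with hc
  have hc0 : c ≠ 0 := div_ne_zero (Complex.exp_ne_zero _) hne
  rw [Matrix.isUnit_iff_isUnit_det, isUnit_iff_ne_zero]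
  intro hdet
  have h0 : (c⁻¹ • (1 : Matrix (Fin n) (Fin n) ℂ) - M).det = 0 := by
    have : c⁻¹ • (1 : Matrix (Fin n) (Fin n) ℂ) - M = c⁻¹ • (1 - c • M) := by
      rw [smul_sub, smul_smul, inv_mul_cancel₀ hc0, one_smul]
    rw [this, Matrix.det_smul, hdet, mul_zero]
  have hlt := hr _ h0
  have hnorm : ‖c⁻¹‖ = ‖lam * (T : ℂ) + 1‖ * Real.exp (lam.re * τu) := by
    rw [hc, inv_div, div_eq_mul_inv, ← Complex.exp_neg, norm_mul, Complex.norm_exp]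
    simp
  have hA : 1 - ε < ‖lam * (T : ℂ) + 1‖ := hre.trans_le (Complex.re_le_norm _)
  have hB : 1 - ε * τu < Real.exp (lam.re * τu) := by
    have := Real.add_one_le_exp (lam.re * τu)
    nlinarith
  have hAB : (1 - ε) * (1 - ε * τu) ≤ ‖lam * (T : ℂ) + 1‖ * Real.exp (lam.re * τu) :=
    mul_le_mul hA.le hB.le (by nlinarith) (norm_nonneg _)
  rw [hnorm] at hlt
  nlinarith
end
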